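/- Let σ > 0, B > 0 with ⟨ψ(x), ψ(x)⟩ ≤ B for all x ∈ X, let T = N·L, let h(x) = ⟨w_h, ψ(x)⟩ for some w_h ∈ H′, let g : X → ℝ satisfy |g(x)| ≤ G·σ for all x with G ≥ 0, set f = h − g, and let x* ∈ X satisfy f(x*) ≥ f(x) for all x ∈ X. Suppose batches X₁, …, X_N (each an L-tuple of points) are chosen so that x* and all selected points are pairwise distinct and X_n maximizes over all L-tuples X = (x¹,…,x^L) the batch acquisition (1/L)·Σ_{i=1}^L m̂_{(n−1)L}(xⁱ) + ‖w_h‖·(2·√(tr(ĉov_{n−1}(X,X))/L) − √(𝟙ᵀ ĉov_{n−1}(X,X) 𝟙 / L²)). Let β > 0 satisfy ‖ĉov_{n−1}(X_n,X_n)‖₂ ≤ β (spectral norm) for all n, set C₄ = 8β / log(1 + β·σ⁻²), and let γ ∈ ℝ satisfy (1/2)·log det(I_T + σ⁻² K_T) ≤ γ, where K_T is the Gram matrix (k(x_i,x_j)) of all T selected points. Then Σ_{t=1}^T (f(x*) − f(x_t)) ≤ ‖w_h‖·√(T·C₄·γ) + 2T·(‖w_h‖ + G)·σ, and f(x*) −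 max_{1≤t≤T} f(x_t) ≤ ‖w_h‖·√(C₄·γ/T) + 2·(‖w_h‖ + G)·σ. -/

import Mathlib

open scoped RealInnerProductSpace
open Matrix

noncomputable section

variable {X : Type*} {H : Type*} {H' : Type*}
  [NormedAddCommGroup H] [InnerProductSpace ℝ H]
  [NormedAddCommGroup H'] [InnerProductSpace ℝ H']

/-- The kernel associated with the feature map `φ`: `k(x,y) = ⟪φ(x), φ(y)⟫`. -/
def ker (φ : X → H) (x y : X) : ℝ := ⟪φ x, φ y⟫

/-- Gram matrix of the points `xs`. -/
def gram (φ : X → H) {t : ℕ} (xs : Fin t → X) : Matrix (Fin t) (Fin t) ℝ :=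
  Matrix.of fun i j => ker φ (xs i) (xs j)

/-- The vector `k_t(a) = (k(a,x₁),…,k(a,x_t))ᵀ`. -/
def kvec (φ : X → H) {t : ℕ} (xs : Fin t → X) (a : X) : Fin t → ℝ :=
  fun i => ker φ a (xs i)

/-- Regularized mean prediction `m̂_t(a) = k_t(a)ᵀ (K_t + σ²I)⁻¹ (h(x₁),…,h(x_t))ᵀ`. -/
def rmeanFn (σ : ℝ) (φ : X → H) (hfun : X → ℝ) {t : ℕ} (xs : Fin t → X) (a : X) : ℝ :=
  kvec φ xs a ⬝ᵥ ((gram φ xs + σ ^ 2 • 1)⁻¹ *ᵥ (fun i => hfun (xs i)))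

/-- Regularized variance `σ̂_t²(a) = k(a,a) − k_t(a)ᵀ (K_t + σ²I)⁻¹ k_t(a)`. -/
def rvarFn (σ : ℝ) (φ : X → H) {t : ℕ} (xs : Fin t → X) (a : X) : ℝ :=
  ker φ a a - kvec φ xs a ⬝ᵥ ((gram φ xs + σ ^ 2 • 1)⁻¹ *ᵥ kvec φ xs a)

/-- `σ̂_t(a) = √(σ̂_t²(a))`. -/
def rsigmaFn (σ : ℝ) (φ : X → H) {t : ℕ} (xs : Fin t → X) (a : X) : ℝ :=
  Real.sqrt (rvarFn σ φ xs a)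

/-- The first `t` points of the sequence `x` (0-indexed: indices `< t`). -/
def prevPts {T : ℕ} (x : Fin T → X) (t : Fin T) : Fin t.val → X :=
  fun j => x ⟨j.val, j.isLt.trans t.isLt⟩

/-- The regularized batch covariance matrix `ĉov(X,X)` after selecting the points `xs`. -/
def rcovMat (σ : ℝ) (φ : X → H) {t L : ℕ} (xs : Fin t → X) (XX : Fin L → X) :
    Matrix (Fin L) (Fin L) ℝ :=
  Matrix.of fun i j =>
    ker φ (XX i) (XX j) -
      kvec φ xs (XX i) ⬝ᵥ ((gram φ xs + σ ^ 2 • 1)⁻¹ *ᵥ kvec φ xs (XX j))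

/-- The regularized batch acquisition function:
`(1/L)·Σᵢ m̂(xⁱ) + w·(2√(tr(ĉov(X,X))/L) − √(𝟙ᵀ ĉov(X,X) 𝟙 / L²))`. -/
def rbatchAcq (σ : ℝ) (φ : X → H) (hfun : X → ℝ) (wnorm : ℝ) {t L : ℕ} (xs : Fin t → X)
    (XX : Fin L → X) : ℝ :=
  (1 / (L : ℝ)) * ∑ i, rmeanFn σ φ hfun xs (XX i) +
    wnorm * (2 * Real.sqrt ((rcovMat σ φ xs XX).trace / (L : ℝ)) -
      Real.sqrt ((∑ i, ∑ j, rcovMat σ φ xs XX i j) / (L : ℝ) ^ 2))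

/-- The first `m` batches of points, flattened into a single sequence of `m·L` points. -/
def flatPts {N L : ℕ} (hL : 0 < L) (xb : Fin N → Fin L → X) (m : ℕ) (hm : m ≤ N) :
    Fin (m * L) → X :=
  fun j => xb ⟨j.val / L, lt_of_lt_of_le ((Nat.div_lt_iff_lt_mul hL).mpr j.isLt) hm⟩
    ⟨j.val % L, Nat.mod_lt _ hL⟩

theorem regGram_posDef (φ : X → H) {σ : ℝ} (hσ : 0 < σ) {t : ℕ} (xs : Fin t → X) :
    (_root_.gram φ xs + σ ^ 2 • (1 : Matrix (Fin t) (Fin t) ℝ)).PosDef := by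
  have h : (_root_.gram φ xs).PosSemidef := Matrix.posSemidef_gram ℝ (fun i => φ (xs i))
  exact Matrix.PosDef.posSemidef_add h (Matrix.PosDef.one.smul (pow_pos hσ 2))

/-- The rectangular matrix of kernel values between two tuples of points. -/
def crossGram (φ : X → H) {t L : ℕ} (xs : Fin t → X) (XX : Fin L → X) :
    Matrix (Fin t) (Fin L) ℝ :=
  Matrix.of fun i j => ker φ (xs i) (XX j)

theorem rcovMat_eq (σ : ℝ) (φ : X → H) {t L : ℕ} (xs : Fin t → X) (XX : Fin L → X) :
    rcovMat σ φ xs XX = _root_.gram φ XX -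
      (crossGram φ xs XX)ᵀ * (_root_.gram φ xs + σ ^ 2 • 1)⁻¹ * crossGram φ xs XX := by
  ext i j
  rw [Matrix.mul_assoc]
  have h : ∀ (a : X) (m : Fin t), ker φ a (xs m) = ker φ (xs m) a :=
    fun a m => real_inner_comm _ _
  simp only [rcovMat, _root_.gram, crossGram, kvec, Matrix.of_apply, Matrix.sub_apply,
    Matrix.mul_apply, dotProduct, mulVec, Matrix.transpose_apply, h (XX i), h (XX j)]

theorem rcovMat_posSemidef (φ : X → H) {σ : ℝ} (hσ : 0 < σ) {t L : ℕ} (xs : Fin t → X)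
    (XX : Fin L → X) : (rcovMat σ φ xs XX).PosSemidef := by
  have hA := regGram_posDef φ hσ xs
  let := hA.isUnit.invertible
  rw [rcovMat_eq, ← Matrix.conjTranspose_eq_transpose_of_trivial,
    ← Matrix.PosDef.fromBlocks₁₁ _ _ hA]
  have h1 : (Matrix.gram ℝ (Sum.elim (fun i => φ (xs i)) (fun i => φ (XX i)))).PosSemidef :=
    Matrix.posSemidef_gram ℝ _
  have h2 : (Matrix.diagonal (Sum.elim (fun _ : Fin t => σ ^ 2) (fun _ : Fin L => 0))).PosSemidef :=
    Matrix.PosSemidef.diagonal (by rintro (i | i) <;> simp [sq_nonneg])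
  convert! h1.add h2 using 1
  ext (i | i) (j | j) <;>
    simp [_root_.gram, crossGram, ker, Matrix.diagonal_apply, Matrix.one_apply, real_inner_comm]

theorem det_regGram_append (φ : X → H) {σ : ℝ} (hσ : 0 < σ) {t L : ℕ} (xs : Fin t → X)
    (XX : Fin L → X) :
    (_root_.gram φ (Fin.append xs XX) + σ ^ 2 • 1).det =
      (_root_.gram φ xs + σ ^ 2 • 1).det * (rcovMat σ φ xs XX + σ ^ 2 • 1).det := by
  have hA := regGram_posDef φ hσ xs
  let := hA.isUnit.invertible
  have key : ((_root_.gram φ (Fin.append xs XX) + σ ^ 2 • 1).submatrix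
      finSumFinEquiv finSumFinEquiv) =
      Matrix.fromBlocks (_root_.gram φ xs + σ ^ 2 • 1) (crossGram φ xs XX) (crossGram φ xs XX)ᵀ
        (_root_.gram φ XX + σ ^ 2 • 1) := by
    ext (i | i) (j | j) <;>
      simp [_root_.gram, crossGram, ker, Matrix.one_apply, real_inner_comm]
    all_goals
      intro h
      have h1 := congrArg Fin.val h
      have h2 := i.isLt
      have h3 := j.isLt
      simp at h1
      omega
  rw [← Matrix.det_submatrix_equiv_self finSumFinEquiv, key, Matrix.det_fromBlocks₁₁,
    rcovMat_eq, Matrix.invOf_eq_nonsing_inv]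
  congr 2
  abel

theorem flatPts_succ {N L : ℕ} (hL : 0 < L) (xb : Fin N → Fin L → X) (m : ℕ) (hm : m + 1 ≤ N) :
    flatPts hL xb (m + 1) hm =
      Fin.append (flatPts hL xb m (Nat.le_of_succ_le hm)) (xb ⟨m, hm⟩) ∘
        Fin.cast (Nat.succ_mul m L) := by
  have hs := Nat.succ_mul m L
  funext j
  obtain ⟨k, rfl⟩ : ∃ k, j = Fin.cast hs.symm k := ⟨Fin.cast hs j, rfl⟩
  induction k using Fin.addCases with
  | left i =>
    simp [flatPts]
  | right i =>
    simp only [flatPts, Function.comp_apply, Fin.cast_cast, Fin.cast_eq_self, Fin.append_right,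
      Fin.val_cast, Fin.val_natAdd]
    congr 1
    · congr 2
      simp [mul_comm m L, Nat.mul_add_div hL, Nat.div_eq_of_lt i.isLt]
    · ext
      simp [Nat.mod_eq_of_lt i.isLt]

theorem det_regGram_flatPts (φ : X → H) {σ : ℝ} (hσ : 0 < σ) {N L : ℕ} (hL : 0 < L)
    (xb : Fin N → Fin L → X) (m : ℕ) (hm : m ≤ N) :
    (_root_.gram φ (flatPts hL xb m hm) + σ ^ 2 • 1).det =
      ∏ n : Fin m, (rcovMat σ φ (flatPts hL xb n.val (n.isLt.le.trans hm))
        (xb ⟨n.val, n.isLt.trans_le hm⟩) + σ ^ 2 • 1).det := by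
  induction m with
  | zero =>
    have : IsEmpty (Fin (0 * L)) := by rw [Nat.zero_mul]; infer_instance
    simp [Matrix.det_isEmpty]
  | succ m ih =>
    rw [Fin.prod_univ_castSucc]
    simp only [Fin.val_castSucc, Fin.val_last]
    rw [← ih (Nat.le_of_succ_le hm), ← det_regGram_append φ hσ, flatPts_succ,
      ← Matrix.det_submatrix_equiv_self (finCongr (Nat.succ_mul m L))]
    congr 1
    ext i j
    simp [_root_.gram, Matrix.one_apply]

theorem Matrix.IsHermitian.det_add_smul_one {n : Type*} [Fintype n] [DecidableEq n]
    {A : Matrix n n ℝ} (hA : A.IsHermitian) (s : ℝ) :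
    (A + s • 1).det = ∏ i, (hA.eigenvalues i + s) := by
  have h := congrArg (Polynomial.eval (-s)) hA.charpoly_eq
  rw [Matrix.eval_charpoly, Polynomial.eval_prod] at h
  have e : Matrix.scalar n (-s) - A = -(A + s • 1) := by
    ext i j
    by_cases hij : i = j <;> simp [hij]
    ring
  have e2 : ∏ i, Polynomial.eval (-s) (Polynomial.X - Polynomial.C (hA.eigenvalues i)) =
      (-1) ^ Fintype.card n * ∏ i, (hA.eigenvalues i + s) := by
    rw [← Finset.card_univ, ← Finset.prod_const, ← Finset.prod_mul_distrib]
    refine Finset.prod_congr rfl fun i _ => ?_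
    simp
    ring
  rw [e, Matrix.det_neg] at h
  exact mul_left_cancel₀ (pow_ne_zero _ (by norm_num)) (h.trans e2)

theorem log_det_flatPts (φ : X → H) {σ : ℝ} (hσ : 0 < σ) {N L : ℕ} (hL : 0 < L)
    (xb : Fin N → Fin L → X)
    (hherm : ∀ n : Fin N, (rcovMat σ φ (flatPts hL xb n.val n.isLt.le) (xb n)).IsHermitian) :
    Real.log ((1 + (σ ^ 2)⁻¹ • _root_.gram φ (flatPts hL xb N le_rfl)).det) =
      ∑ n, ∑ i, Real.log (1 + (hherm n).eigenvalues i * (σ ^ 2)⁻¹) := by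
  have hs : 0 < σ ^ 2 := pow_pos hσ 2
  have hpos : ∀ n i, 0 < 1 + (hherm n).eigenvalues i * (σ ^ 2)⁻¹ := fun n i => by
    have := (rcovMat_posSemidef φ hσ (flatPts hL xb n.val n.isLt.le) (xb n)).eigenvalues_nonneg i
    positivity
  have e : (1 + (σ ^ 2)⁻¹ • _root_.gram φ (flatPts hL xb N le_rfl)) =
      (σ ^ 2)⁻¹ • (_root_.gram φ (flatPts hL xb N le_rfl) + σ ^ 2 • 1) := by
    rw [smul_add, smul_smul, inv_mul_cancel₀ hs.ne', one_smul, add_comm]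
  have e2 : (1 + (σ ^ 2)⁻¹ • _root_.gram φ (flatPts hL xb N le_rfl)).det =
      ∏ n, ∏ i, (1 + (hherm n).eigenvalues i * (σ ^ 2)⁻¹) := by
    rw [e, Matrix.det_smul, det_regGram_flatPts φ hσ, Fintype.card_fin, pow_mul', ← Fin.prod_const,
      ← Finset.prod_mul_distrib]
    refine Finset.prod_congr rfl fun n _ => ?_
    rw [Matrix.IsHermitian.det_add_smul_one (hherm n), ← Fin.prod_const,
      ← Finset.prod_mul_distrib]
    refine Finset.prod_congr rfl fun i _ => ?_
    field_simp
    ring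
  rw [e2, Real.log_prod fun n _ => (Finset.prod_pos fun i _ => hpos n i).ne']
  exact Finset.sum_congr rfl fun n _ => Real.log_prod fun i _ => (hpos n i).ne'

theorem mul_log_one_add_le {l β s : ℝ} (hl : 0 ≤ l) (hlβ : l ≤ β) (hβ : 0 < β) (hs : 0 < s) :
    l * Real.log (1 + β * s) ≤ β * Real.log (1 + l * s) := by
  have h := strictConcaveOn_log_Ioi.concaveOn.2 (show (1 : ℝ) ∈ Set.Ioi 0 by simp)
    (show 1 + β * s ∈ Set.Ioi 0 from Set.mem_Ioi.2 (by positivity))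
    (show 0 ≤ 1 - l / β by rw [sub_nonneg, div_le_one hβ]; exact hlβ)
    (show 0 ≤ l / β by positivity) (by ring)
  simp only [smul_eq_mul, Real.log_one, mul_zero, zero_add] at h
  have e : (1 - l / β) * 1 + l / β * (1 + β * s) = 1 + l * s := by field_simp; ring
  rw [e] at h
  calc l * Real.log (1 + β * s) = β * (l / β * Real.log (1 + β * s)) := by field_simp
    _ ≤ _ := mul_le_mul_of_nonneg_left h hβ.le

theorem sum_trace_rcovMat_le (φ : X → H) {σ : ℝ} (hσ : 0 < σ) {N L : ℕ} (hL : 0 < L)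
    (xb : Fin N → Fin L → X) {β : ℝ} (hβpos : 0 < β)
    (hherm : ∀ n : Fin N, (rcovMat σ φ (flatPts hL xb n.val n.isLt.le) (xb n)).IsHermitian)
    (hβ : ∀ n : Fin N, ∀ i : Fin L, |(hherm n).eigenvalues i| ≤ β)
    {γ : ℝ}
    (hγ : (1 / 2) * Real.log
      ((1 + (σ ^ 2)⁻¹ • _root_.gram φ (flatPts hL xb N le_rfl)).det) ≤ γ) :
    4 * ∑ n : Fin N, (rcovMat σ φ (flatPts hL xb n.val n.isLt.le) (xb n)).trace ≤
      (8 * β / Real.log (1 + β * (σ ^ 2)⁻¹)) * γ := by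
  have hs : 0 < (σ ^ 2)⁻¹ := by positivity
  have hlog : 0 < Real.log (1 + β * (σ ^ 2)⁻¹) :=
    Real.log_pos (lt_add_of_pos_right _ (mul_pos hβpos hs))
  rw [log_det_flatPts φ hσ hL xb hherm] at hγ
  rw [div_mul_eq_mul_div, le_div_iff₀ hlog, mul_assoc, Finset.sum_mul]
  have h : ∑ n : Fin N, (rcovMat σ φ (flatPts hL xb n.val n.isLt.le) (xb n)).trace *
      Real.log (1 + β * (σ ^ 2)⁻¹) ≤
      β * ∑ n, ∑ i, Real.log (1 + (hherm n).eigenvalues i * (σ ^ 2)⁻¹) := by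
    rw [Finset.mul_sum]
    refine Finset.sum_le_sum fun n _ => ?_
    rw [(hherm n).trace_eq_sum_eigenvalues, Finset.mul_sum, Finset.sum_mul]
    refine Finset.sum_le_sum fun i _ => ?_
    exact mul_log_one_add_le
      ((rcovMat_posSemidef φ hσ (flatPts hL xb n.val n.isLt.le) (xb n)).eigenvalues_nonneg i)
      ((le_abs_self _).trans (hβ n i)) hβpos hs
  have := mul_le_mul_of_nonneg_left hγ hβpos.le
  linarith

/-- The regularized covariance between two points after observing `xs`. -/
def rcovFn (σ : ℝ) (φ : X → H) {t : ℕ} (xs : Fin t → X) (a b : X) : ℝ :=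
  ker φ a b - kvec φ xs a ⬝ᵥ ((_root_.gram φ xs + σ ^ 2 • 1)⁻¹ *ᵥ kvec φ xs b)

/-- The residual of `ψ a` after regression on the features of the points `xs`. -/
def resid (σ : ℝ) (φ : X → H) (ψ : X → H') {t : ℕ} (xs : Fin t → X) (a : X) : H' :=
  ψ a - ∑ j, ((_root_.gram φ xs + σ ^ 2 • 1)⁻¹ *ᵥ kvec φ xs a) j • ψ (xs j)

section Residual

variable {φ : X → H} {ψ : X → H'} {σ : ℝ} {t : ℕ} {xs : Fin t → X}

theorem inner_resid (hσ : 0 < σ) {wh : H'} {hfun : X → ℝ} (hh : ∀ a, hfun a = ⟪wh, ψ a⟫)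
    (a : X) : ⟪wh, resid σ φ ψ xs a⟫ = hfun a - rmeanFn σ φ hfun xs a := by
  have hsymm : ((_root_.gram φ xs + σ ^ 2 • 1)⁻¹)ᵀ = (_root_.gram φ xs + σ ^ 2 • 1)⁻¹ := by
    rw [← Matrix.conjTranspose_eq_transpose_of_trivial]
    exact (regGram_posDef φ hσ xs).inv.isHermitian
  rw [resid, inner_sub_right, inner_sum, ← hh, rmeanFn, Matrix.dotProduct_mulVec,
    ← Matrix.mulVec_transpose, hsymm]
  simp only [inner_smul_right, ← hh, dotProduct]

variable [DecidableEq X]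

theorem inner_resid_feature (hσ : 0 < σ)
    (hker : ∀ a b : X, (⟪ψ a, ψ b⟫ : ℝ) = ⟪φ a, φ b⟫ + σ ^ 2 * (if a = b then 1 else 0))
    (hxs : Function.Injective xs) {a : X} (ha : ∀ i, xs i ≠ a) (i : Fin t) :
    ⟪ψ (xs i), resid σ φ ψ xs a⟫ = 0 := by
  have h : ((_root_.gram φ xs + σ ^ 2 • 1) *ᵥ
      ((_root_.gram φ xs + σ ^ 2 • 1)⁻¹ *ᵥ kvec φ xs a)) i = kvec φ xs a i := by
    rw [Matrix.mulVec_mulVec, Matrix.mul_nonsing_inv _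
      ((Matrix.isUnit_iff_isUnit_det _).1 (regGram_posDef φ hσ xs).isUnit), Matrix.one_mulVec]
  rw [resid, inner_sub_right, inner_sum, hker, if_neg (ha i), mul_zero, add_zero, sub_eq_zero]
  have hk : kvec φ xs a i = ⟪φ (xs i), φ a⟫ := real_inner_comm _ _
  rw [← hk, ← h, mulVec, dotProduct]
  refine Finset.sum_congr rfl fun j _ => ?_
  rw [inner_smul_right, hker, mul_comm]
  simp [_root_.gram, ker, Matrix.one_apply, hxs.eq_iff]

theorem inner_resid_resid (hσ : 0 < σ)
    (hker : ∀ a b : X, (⟪ψ a, ψ b⟫ : ℝ) = ⟪φ a, φ b⟫ + σ ^ 2 * (if a = b then 1 else 0))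
    (hxs : Function.Injective xs) {a b : X} (ha : ∀ i, xs i ≠ a) (hb : ∀ i, xs i ≠ b) :
    ⟪resid σ φ ψ xs a, resid σ φ ψ xs b⟫ =
      rcovFn σ φ xs a b + σ ^ 2 * (if a = b then 1 else 0) := by
  have h1 : ⟪resid σ φ ψ xs a, resid σ φ ψ xs b⟫ = ⟪ψ a, resid σ φ ψ xs b⟫ := by
    rw [resid, inner_sub_left, sum_inner]
    simp [inner_smul_left, inner_resid_feature hσ hker hxs hb]
  rw [h1, resid, inner_sub_right, inner_sum, hker, rcovFn, ker, dotProduct, add_sub_right_comm]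
  congr 2
  refine Finset.sum_congr rfl fun j _ => ?_
  rw [inner_smul_right, hker, if_neg (ha j).symm, mul_zero, add_zero, mul_comm]
  rfl

theorem abs_sum_sub_rmeanFn_le (hσ : 0 < σ)
    (hker : ∀ a b : X, (⟪ψ a, ψ b⟫ : ℝ) = ⟪φ a, φ b⟫ + σ ^ 2 * (if a = b then 1 else 0))
    {wh : H'} {hfun : X → ℝ} (hh : ∀ a, hfun a = ⟪wh, ψ a⟫)
    (hxs : Function.Injective xs) {L : ℕ} {XX : Fin L → X} (hXX : Function.Injective XX)
    (hne : ∀ i j, xs i ≠ XX j) :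
    |∑ i, (hfun (XX i) - rmeanFn σ φ hfun xs (XX i))| ≤
      ‖wh‖ * Real.sqrt ((∑ i, ∑ j, rcovMat σ φ xs XX i j) + L * σ ^ 2) := by
  have h1 : ∑ i, (hfun (XX i) - rmeanFn σ φ hfun xs (XX i)) =
      ⟪wh, ∑ i, resid σ φ ψ xs (XX i)⟫ := by
    rw [inner_sum]
    exact Finset.sum_congr rfl fun i _ => (inner_resid hσ hh _).symm
  have h2 : ‖∑ i, resid σ φ ψ xs (XX i)‖ =
      Real.sqrt ((∑ i, ∑ j, rcovMat σ φ xs XX i j) + L * σ ^ 2) := by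
    rw [norm_eq_sqrt_real_inner, sum_inner]
    congr 1
    simp only [inner_sum, inner_resid_resid hσ hker hxs (fun i => hne i _) (fun i => hne i _),
      Finset.sum_add_distrib, hXX.eq_iff]
    simp [rcovMat, rcovFn]
  rw [h1, ← h2]
  exact abs_real_inner_le_norm _ _

/-- The regret of the average over a batch maximizing the acquisition function. -/
theorem batch_regret_le (hσ : 0 < σ)
    (hker : ∀ a b : X, (⟪ψ a, ψ b⟫ : ℝ) = ⟪φ a, φ b⟫ + σ ^ 2 * (if a = b then 1 else 0))
    {wh : H'} {hfun : X → ℝ} (hh : ∀ a, hfun a = ⟪wh, ψ a⟫)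
    (hxs : Function.Injective xs) {L : ℕ} (hL : 0 < L) {XX : Fin L → X}
    (hXX : Function.Injective XX) (hne : ∀ i j, xs i ≠ XX j)
    {xstar : X} (hstar : ∀ i, xs i ≠ xstar)
    (hacq : rbatchAcq σ φ hfun ‖wh‖ xs (fun _ : Fin L => xstar) ≤
      rbatchAcq σ φ hfun ‖wh‖ xs XX) :
    ∑ i, (hfun xstar - hfun (XX i)) ≤
      2 * ‖wh‖ * Real.sqrt (L * (rcovMat σ φ xs XX).trace) + 2 * L * ‖wh‖ * σ := by
  have hL' : (0 : ℝ) < L := Nat.cast_pos.2 hL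
  have hw := norm_nonneg wh
  set v := rcovFn σ φ xs xstar xstar with hv
  have hv0 : 0 ≤ v :=
    (rcovMat_posSemidef φ hσ xs (fun _ : Fin 1 => xstar)).diag_nonneg (i := 0)
  have hstarAcq : rbatchAcq σ φ hfun ‖wh‖ xs (fun _ : Fin L => xstar) =
      rmeanFn σ φ hfun xs xstar + ‖wh‖ * Real.sqrt v := by
    have e : rcovMat σ φ xs (fun _ : Fin L => xstar) = Matrix.of fun _ _ => v := rfl
    have e1 : (L : ℝ) * v / L = v := by field_simp
    have e2 : (L : ℝ) * (L * v) / L ^ 2 = v := by field_simp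
    simp only [rbatchAcq, e, Matrix.trace, Matrix.diag, Matrix.of_apply, Finset.sum_const,
      Finset.card_univ, Fintype.card_fin, nsmul_eq_mul, e1, e2]
    field_simp
    ring
  have hs1 : hfun xstar - rmeanFn σ φ hfun xs xstar ≤ ‖wh‖ * (Real.sqrt v + σ) := by
    have h := abs_sum_sub_rmeanFn_le hσ hker hh hxs (L := 1) (XX := fun _ => xstar)
      (Function.injective_of_subsingleton _) (fun i _ => hstar i)
    simp only [Fin.sum_univ_one, Nat.cast_one, one_mul] at h
    refine (le_abs_self _).trans (h.trans (mul_le_mul_of_nonneg_left ?_ hw))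
    refine (Real.sqrt_le_left (by positivity)).2 ?_
    have := Real.sq_sqrt hv0
    change v + σ ^ 2 ≤ _
    nlinarith [mul_nonneg (Real.sqrt_nonneg v) hσ.le]
  set S := ∑ i, ∑ j, rcovMat σ φ xs XX i j with hS
  have hS0 : 0 ≤ S := by
    have h := (rcovMat_posSemidef φ hσ xs XX).dotProduct_mulVec_nonneg (fun _ => 1)
    simpa [dotProduct, mulVec] using h
  have hbatch : ∑ i, rmeanFn σ φ hfun xs (XX i) - ∑ i, hfun (XX i) ≤
      ‖wh‖ * (Real.sqrt S + L * σ) := by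
    have h := abs_sum_sub_rmeanFn_le hσ hker hh hxs hXX hne
    rw [Finset.sum_sub_distrib, abs_sub_comm] at h
    refine (le_abs_self _).trans (h.trans (mul_le_mul_of_nonneg_left ?_ hw))
    refine (Real.sqrt_le_left (by positivity)).2 ?_
    have := Real.sq_sqrt hS0
    have h1 : (1 : ℝ) ≤ L := Nat.one_le_cast.2 hL
    have h2 : (L : ℝ) * σ ^ 2 ≤ L ^ 2 * σ ^ 2 := by
      gcongr
      nlinarith
    nlinarith [mul_nonneg (Real.sqrt_nonneg S) (mul_nonneg hL'.le hσ.le)]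
  rw [hstarAcq, rbatchAcq, ← hS, Real.sqrt_div hS0, Real.sqrt_sq hL'.le] at hacq
  have htr : (L : ℝ) * Real.sqrt ((rcovMat σ φ xs XX).trace / L) =
      Real.sqrt (L * (rcovMat σ φ xs XX).trace) := by
    rw [← Real.sqrt_sq hL'.le, ← Real.sqrt_mul (sq_nonneg _), Real.sqrt_sq hL'.le]
    congr 1
    field_simp
  have hacq' := mul_le_mul_of_nonneg_left hacq hL'.le
  have e : (L : ℝ) * (1 / (L : ℝ) * ∑ i, rmeanFn σ φ hfun xs (XX i) +
      ‖wh‖ * (2 * Real.sqrt ((rcovMat σ φ xs XX).trace / L) - Real.sqrt S / L)) =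
      ∑ i, rmeanFn σ φ hfun xs (XX i) +
        ‖wh‖ * (2 * Real.sqrt (L * (rcovMat σ φ xs XX).trace) - Real.sqrt S) := by
    rw [← htr]
    field_simp
  rw [e] at hacq'
  rw [Finset.sum_sub_distrib, Finset.sum_const, Finset.card_univ, Fintype.card_fin, nsmul_eq_mul]
  have hs2 := mul_le_mul_of_nonneg_left hs1 hL'.le
  linarith

end Residual

theorem flatPts_injective {N L : ℕ} (hL : 0 < L) {xb : Fin N → Fin L → X}
    (hinj : Function.Injective (fun p : Fin N × Fin L => xb p.1 p.2)) (m : ℕ) (hm : m ≤ N) :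
    Function.Injective (flatPts hL xb m hm) := by
  intro i j hij
  have h := hinj (a₁ := (_, _)) (a₂ := (_, _)) hij
  simp only [Prod.mk.injEq, Fin.mk.injEq] at h
  ext
  rw [← Nat.div_add_mod i.val L, ← Nat.div_add_mod j.val L, h.1, h.2]

theorem sum_sqrt_le {ι : Type*} [Fintype ι] {a : ι → ℝ} (ha : ∀ i, 0 ≤ a i) :
    ∑ i, Real.sqrt (a i) ≤ Real.sqrt (Fintype.card ι * ∑ i, a i) := by
  have h := Real.sum_sqrt_mul_sqrt_le Finset.univ (f := fun _ => 1) (g := a)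
    (fun _ => zero_le_one) ha
  simpa [Real.sqrt_mul] using h

/-- Theorem 4 (perturbation-setting batch regret bounds). -/
theorem statement_4 [Nonempty X] [DecidableEq X]
    (φ : X → H) (ψ : X → H')
    (σ : ℝ) (hσ : 0 < σ) (B : ℝ) (hB : 0 < B)
    (hker : ∀ a b : X, (⟪ψ a, ψ b⟫ : ℝ) = ⟪φ a, φ b⟫ + σ ^ 2 * (if a = b then 1 else 0))
    (hkB : ∀ a : X, (⟪ψ a, ψ a⟫ : ℝ) ≤ B)
    (wh : H') (hfun : X → ℝ) (hh : ∀ a, hfun a = ⟪wh, ψ a⟫)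
    (g : X → ℝ) (G : ℝ) (hG : 0 ≤ G) (hg : ∀ a : X, |g a| ≤ G * σ)
    (f : X → ℝ) (hfdef : ∀ a, f a = hfun a - g a)
    (N L : ℕ) (hN : 0 < N) (hL : 0 < L)
    (xstar : X) (hstar : ∀ a : X, f a ≤ f xstar)
    (xb : Fin N → Fin L → X)
    (hinj : Function.Injective (fun p : Fin N × Fin L => xb p.1 p.2))
    (hne : ∀ (n : Fin N) (i : Fin L), xb n i ≠ xstar)
    (hacq : ∀ n : Fin N, ∀ XX : Fin L → X,
      rbatchAcq σ φ hfun ‖wh‖ (flatPts hL xb n.val n.isLt.le) XX ≤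
        rbatchAcq σ φ hfun ‖wh‖ (flatPts hL xb n.val n.isLt.le) (xb n))
    (β : ℝ) (hβpos : 0 < β)
    (hherm : ∀ n : Fin N, (rcovMat σ φ (flatPts hL xb n.val n.isLt.le) (xb n)).IsHermitian)
    (hβ : ∀ n : Fin N, ∀ i : Fin L, |(hherm n).eigenvalues i| ≤ β)
    (γ : ℝ)
    (hγ : (1/2) * Real.log ((1 + (σ^2)⁻¹ • gram φ (flatPts hL xb N le_rfl)).det) ≤ γ) :
    (∑ n : Fin N, ∑ i : Fin L, (f xstar - f (xb n i))) ≤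
        ‖wh‖ * Real.sqrt (((N * L : ℕ) : ℝ) * (8 * β / Real.log (1 + β * (σ^2)⁻¹)) * γ) +
          2 * ((N * L : ℕ) : ℝ) * (‖wh‖ + G) * σ ∧
    f xstar - (Finset.univ.sup'
        (Finset.univ_nonempty_iff.mpr ⟨(⟨0, hN⟩, ⟨0, hL⟩)⟩)
        fun p : Fin N × Fin L => f (xb p.1 p.2)) ≤
      ‖wh‖ * Real.sqrt ((8 * β / Real.log (1 + β * (σ^2)⁻¹)) * γ / ((N * L : ℕ) : ℝ)) +
        2 * (‖wh‖ + G) * σ := by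
  have hN' : (0 : ℝ) < N := Nat.cast_pos.2 hN
  have hL' : (0 : ℝ) < L := Nat.cast_pos.2 hL
  have hT : (0 : ℝ) < ((N * L : ℕ) : ℝ) := Nat.cast_pos.2 (Nat.mul_pos hN hL)
  have hsum : (∑ n : Fin N, ∑ i : Fin L, (f xstar - f (xb n i))) ≤
      ‖wh‖ * Real.sqrt (((N * L : ℕ) : ℝ) * (8 * β / Real.log (1 + β * (σ^2)⁻¹)) * γ) +
        2 * ((N * L : ℕ) : ℝ) * (‖wh‖ + G) * σ := by
    set C : Fin N → Matrix (Fin L) (Fin L) ℝ :=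
      fun n => rcovMat σ φ (flatPts hL xb n.val n.isLt.le) (xb n) with hC
    have hbatch : ∀ n : Fin N, ∑ i : Fin L, (f xstar - f (xb n i)) ≤
        2 * ‖wh‖ * Real.sqrt (L * (C n).trace) + 2 * L * (‖wh‖ + G) * σ := by
      intro n
      have h := batch_regret_le hσ hker hh (flatPts_injective hL hinj n.val n.isLt.le) hL
        (XX := xb n) (fun i j hij => (Prod.mk.inj (hinj (a₁ := (n, i)) (a₂ := (n, j)) hij)).2)
        (fun i j hij => by
          have h := (Prod.mk.inj (hinj (a₁ := (_, _)) (a₂ := (n, j)) hij)).1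
          have h1 := congrArg Fin.val h
          have h2 := (Nat.div_lt_iff_lt_mul hL).mpr i.isLt
          exact h2.ne h1)
        (xstar := xstar) (fun i => hne _ _) (hacq n _)
      have hfh : ∑ i : Fin L, (f xstar - f (xb n i)) ≤
          ∑ i : Fin L, ((hfun xstar - hfun (xb n i)) + 2 * (G * σ)) := by
        refine Finset.sum_le_sum fun i _ => ?_
        rw [hfdef, hfdef]
        have h1 := (abs_le.1 (hg xstar)).1
        have h2 := (abs_le.1 (hg (xb n i))).2
        linarith
      rw [Finset.sum_add_distrib, Finset.sum_const, Finset.card_univ, Fintype.card_fin,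
        nsmul_eq_mul] at hfh
      linarith
    have htr : ∀ n, 0 ≤ (C n).trace := fun n => (rcovMat_posSemidef φ hσ _ _).trace_nonneg
    have hroot : 2 * ∑ n, Real.sqrt (L * (C n).trace) ≤
        Real.sqrt (((N * L : ℕ) : ℝ) * (8 * β / Real.log (1 + β * (σ^2)⁻¹)) * γ) := by
      have h := sum_sqrt_le (a := fun n => L * (C n).trace) fun n => mul_nonneg hL'.le (htr n)
      have h4 : (2 : ℝ) = Real.sqrt 4 := by
        rw [show (4 : ℝ) = 2 ^ 2 by norm_num, Real.sqrt_sq (by norm_num)]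
      refine (mul_le_mul_of_nonneg_left h zero_le_two).trans ?_
      rw [h4, ← Real.sqrt_mul (by norm_num)]
      refine Real.sqrt_le_sqrt ?_
      have hb := mul_le_mul_of_nonneg_left
        (sum_trace_rcovMat_le φ hσ hL xb hβpos hherm hβ hγ) hT.le
      rw [← Finset.mul_sum, Fintype.card_fin]
      push_cast at hb ⊢
      linarith
    refine (Finset.sum_le_sum fun n _ => hbatch n).trans ?_
    rw [Finset.sum_add_distrib, ← Finset.mul_sum, Finset.sum_const, Finset.card_univ,
      Fintype.card_fin, nsmul_eq_mul]
    have := mul_le_mul_of_nonneg_left hroot (norm_nonneg wh)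
    push_cast at this ⊢
    linarith
  refine ⟨hsum, ?_⟩
  set M := Finset.univ.sup'
    (Finset.univ_nonempty_iff.mpr ⟨((⟨0, hN⟩, ⟨0, hL⟩) : Fin N × Fin L)⟩)
    fun p : Fin N × Fin L => f (xb p.1 p.2) with hM
  have hlow : ((N * L : ℕ) : ℝ) * (f xstar - M) ≤
      ∑ n : Fin N, ∑ i : Fin L, (f xstar - f (xb n i)) := by
    have h : ∑ _n : Fin N, ∑ _i : Fin L, (f xstar - M) ≤
        ∑ n : Fin N, ∑ i : Fin L, (f xstar - f (xb n i)) := by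
      refine Finset.sum_le_sum fun n _ => Finset.sum_le_sum fun i _ => sub_le_sub_left ?_ _
      exact Finset.le_sup' (fun p : Fin N × Fin L => f (xb p.1 p.2)) (Finset.mem_univ (n, i))
    rw [Finset.sum_const, Finset.sum_const, Finset.card_univ, Finset.card_univ, Fintype.card_fin,
      Fintype.card_fin, smul_smul, nsmul_eq_mul] at h
    exact h
  refine le_of_mul_le_mul_left (hlow.trans (hsum.trans (le_of_eq ?_))) hT
  set T := ((N * L : ℕ) : ℝ)
  have hroot : T * Real.sqrt ((8 * β / Real.log (1 + β * (σ^2)⁻¹)) * γ / T) =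
      Real.sqrt (T * (8 * β / Real.log (1 + β * (σ^2)⁻¹)) * γ) := by
    nth_rewrite 1 [← Real.sqrt_sq hT.le]
    rw [← Real.sqrt_mul (sq_nonneg _)]
    congr 1
    field_simp
  rw [← hroot]
  ring
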